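/- Let a, b, c, d, o be points of the Euclidean plane ℝ² and let r be a real number with dist o a = r, dist o b = r, dist o c = r (so a, b, c lie on a common circle with center o and radius r), and b ≠ c. If dist o d < r (d is strictly inside this circle) and a and d lie strictly on opposite sides of the line through b and c, then ∠ b a c + ∠ b d c > π. -/

import Mathlib

open EuclideanGeometry Real

/-- Twice the signed area of the triangle `x b c`. -/
def signedArea (x b c : EuclideanSpace ℝ (Fin 2)) : ℝ :=
  (b 0 - x 0) * (c 1 - x 1) - (b 1 - x 1) * (c 0 - x 0)

lemma inner_vsub_vsub_eq_coord (x b c : EuclideanSpace ℝ (Fin 2)) :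
    inner ℝ (b -ᵥ x) (c -ᵥ x) =
      (b 0 - x 0) * (c 0 - x 0) + (b 1 - x 1) * (c 1 - x 1) := by
  simp only [vsub_eq_sub, PiLp.inner_apply, Fin.sum_univ_two, PiLp.sub_apply, RCLike.inner_apply,
    conj_trivial]
  ring

lemma dist_sq_eq_coord (x y : EuclideanSpace ℝ (Fin 2)) :
    dist x y ^ 2 = (x 0 - y 0) ^ 2 + (x 1 - y 1) ^ 2 := by
  rw [EuclideanSpace.dist_eq, Real.sq_sqrt (by positivity), Fin.sum_univ_two, Real.dist_eq,
    Real.dist_eq, sq_abs, sq_abs]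

lemma sin_angle_mul_norm_mul_norm_eq_abs_signedArea (x b c : EuclideanSpace ℝ (Fin 2)) :
    sin (∠ b x c) * (‖b -ᵥ x‖ * ‖c -ᵥ x‖) = |signedArea x b c| := by
  rw [EuclideanGeometry.angle, InnerProductGeometry.sin_angle_mul_norm_mul_norm,
    ← Real.sqrt_sq_eq_abs]
  congr 1
  simp only [inner_vsub_vsub_eq_coord, signedArea]
  ring

lemma mem_affineSpan_pair_of_signedArea_eq_zero {a b c : EuclideanSpace ℝ (Fin 2)}
    (hbc : b ≠ c) (h : signedArea a b c = 0) : a ∈ affineSpan ℝ {b, c} := by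
  have hN : (b 0 - c 0) ^ 2 + (b 1 - c 1) ^ 2 ≠ 0 := by
    rw [← dist_sq_eq_coord]
    exact pow_ne_zero 2 (dist_ne_zero.2 hbc)
  have key : a = AffineMap.lineMap b c
      (((a 0 - b 0) * (c 0 - b 0) + (a 1 - b 1) * (c 1 - b 1)) /
        ((b 0 - c 0) ^ 2 + (b 1 - c 1) ^ 2)) := by
    unfold signedArea at h
    ext i
    fin_cases i <;>
      simp only [AffineMap.lineMap_apply, vsub_eq_sub, vadd_eq_add, PiLp.add_apply,
        PiLp.smul_apply, PiLp.sub_apply, smul_eq_mul, Fin.zero_eta, Fin.mk_one] <;>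
      field_simp
    · linear_combination (b 1 - c 1) * h
    · linear_combination (c 0 - b 0) * h
  rw [key]
  exact AffineMap.lineMap_mem_affineSpan_pair _ _ _

lemma signedArea_mul_signedArea_neg {a b c d : EuclideanSpace ℝ (Fin 2)} (hbc : b ≠ c)
    (h : AffineSubspace.SOppSide (affineSpan ℝ {b, c}) a d) :
    signedArea a b c * signedArea d b c < 0 := by
  have ha : signedArea a b c ≠ 0 := fun h0 =>
    h.2.1 (mem_affineSpan_pair_of_signedArea_eq_zero hbc h0)
  have hd : signedArea d b c ≠ 0 := fun h0 =>
    h.2.2 (mem_affineSpan_pair_of_signedArea_eq_zero hbc h0)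
  obtain ⟨p, hp, ⟨k, ⟨hk0, hk1⟩, hk⟩, -, -⟩ := h.exists_sbtw
  obtain ⟨t, ht⟩ := mem_affineSpan_pair_iff_exists_lineMap_eq.1 hp
  have hpt := hk.trans ht.symm
  have h0 := congrArg (fun v : EuclideanSpace ℝ (Fin 2) => v 0) hpt
  have h1 := congrArg (fun v : EuclideanSpace ℝ (Fin 2) => v 1) hpt
  simp only [AffineMap.lineMap_apply, vsub_eq_sub, vadd_eq_add, PiLp.add_apply,
    PiLp.smul_apply, PiLp.sub_apply, smul_eq_mul] at h0 h1
  have hs : (1 - k) * signedArea a b c + k * signedArea d b c = 0 := by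
    unfold signedArea
    linear_combination (b 1 - c 1) * h0 + (c 0 - b 0) * h1
  refine lt_of_le_of_ne (not_lt.1 fun hpos => ?_) (mul_ne_zero ha hd)
  have ha2 : 0 < signedArea a b c ^ 2 := by positivity
  have hsum : (1 - k) * signedArea a b c ^ 2 + k * (signedArea a b c * signedArea d b c) = 0 := by
    linear_combination signedArea a b c * hs
  rcases hk0.eq_or_lt with rfl | hk0
  · linarith
  · linarith [mul_pos hk0 hpos, mul_nonneg (sub_nonneg.2 hk1) ha2.le]

lemma signedArea_mul_inner_sub_eq_signedArea_mul_power {a b c d o : EuclideanSpace ℝ (Fin 2)}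
    {r : ℝ} (ha : dist o a = r) (hb : dist o b = r) (hc : dist o c = r) :
    signedArea a b c * inner ℝ (b -ᵥ d) (c -ᵥ d) - inner ℝ (b -ᵥ a) (c -ᵥ a) * signedArea d b c =
      signedArea a b c * (dist o d ^ 2 - r ^ 2) := by
  replace ha := congrArg (· ^ 2) ha
  replace hb := congrArg (· ^ 2) hb
  replace hc := congrArg (· ^ 2) hc
  simp only [dist_sq_eq_coord] at ha hb hc
  simp only [inner_vsub_vsub_eq_coord, dist_sq_eq_coord]
  unfold signedArea
  linear_combination
    (-((b 0 - d 0) * (c 1 - d 1) - (b 1 - d 1) * (c 0 - d 0))) * ha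
    - ((d 0 - a 0) * (c 1 - a 1) - (d 1 - a 1) * (c 0 - a 0)) * hb
    - ((b 0 - a 0) * (d 1 - a 1) - (b 1 - a 1) * (d 0 - a 0)) * hc

theorem bb_opposite_angles_sum_gt_pi
    (a b c d o : EuclideanSpace ℝ (Fin 2)) (r : ℝ)
    (ha : dist o a = r) (hb : dist o b = r) (hc : dist o c = r)
    (hbc : b ≠ c)
    (hd : dist o d < r)
    (hside : AffineSubspace.SOppSide (affineSpan ℝ {b, c}) a d) :
    ∠ b a c + ∠ b d c > π := by
  have hneg := signedArea_mul_signedArea_neg hbc hside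
  have hpow : dist o d ^ 2 - r ^ 2 < 0 :=
    sub_neg.2 (pow_lt_pow_left₀ hd dist_nonneg two_ne_zero)
  have key := signedArea_mul_inner_sub_eq_signedArea_mul_power (d := d) ha hb hc
  have hsa := sin_angle_mul_norm_mul_norm_eq_abs_signedArea a b c
  have hsd := sin_angle_mul_norm_mul_norm_eq_abs_signedArea d b c
  have hca : cos (∠ b a c) * (‖b -ᵥ a‖ * ‖c -ᵥ a‖) = _ :=
    InnerProductGeometry.cos_angle_mul_norm_mul_norm (b -ᵥ a) (c -ᵥ a)
  have hcd : cos (∠ b d c) * (‖b -ᵥ d‖ * ‖c -ᵥ d‖) = _ :=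
    InnerProductGeometry.cos_angle_mul_norm_mul_norm (b -ᵥ d) (c -ᵥ d)
  have hsin : sin (∠ b a c + ∠ b d c) * (‖b -ᵥ a‖ * ‖c -ᵥ a‖ * (‖b -ᵥ d‖ * ‖c -ᵥ d‖)) =
      |signedArea a b c| * (dist o d ^ 2 - r ^ 2) := by
    have hexp : sin (∠ b a c + ∠ b d c) * (‖b -ᵥ a‖ * ‖c -ᵥ a‖ * (‖b -ᵥ d‖ * ‖c -ᵥ d‖)) =
        |signedArea a b c| * inner ℝ (b -ᵥ d) (c -ᵥ d) +
          inner ℝ (b -ᵥ a) (c -ᵥ a) * |signedArea d b c| := by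
      rw [sin_add, ← hsa, ← hsd, ← hca, ← hcd]
      ring
    rw [hexp]
    rcases mul_neg_iff.1 hneg with ⟨h1, h2⟩ | ⟨h1, h2⟩
    · rw [abs_of_pos h1, abs_of_neg h2]
      linear_combination key
    · rw [abs_of_neg h1, abs_of_pos h2]
      linear_combination -key
  have hlt : |signedArea a b c| * (dist o d ^ 2 - r ^ 2) < 0 :=
    mul_neg_of_pos_of_neg (abs_pos.2 (left_ne_zero_of_mul hneg.ne)) hpow
  by_contra hle
  have hnonneg : 0 ≤ sin (∠ b a c + ∠ b d c) :=
    sin_nonneg_of_nonneg_of_le_pi (add_nonneg (angle_nonneg _ _ _) (angle_nonneg _ _ _))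
      (not_lt.1 hle)
  rw [← hsin] at hlt
  exact absurd hlt (not_lt.2 (by positivity))
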